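/- There are at least 4.5·10⁵ MSTD subsets of {0,1,…,29}: the number of subsets A of {0,1,…,29} with |A+A| > |A−A| is at least 450000. -/

import Mathlib

open Pointwise
/-- pattern -/
def blk (F j : ℕ) : ℕ := Nat.div (Nat.sub (Nat.pow 2 (Nat.pow 2 F)) 1) (Nat.add (Nat.pow 2 (Nat.pow 2 j)) 1)
def ones (F : ℕ) : ℕ := Nat.sub (Nat.pow 2 (Nat.pow 2 F)) 1
def orL (l : List ℕ) : List ℕ → List ℕ :=
  List.rec (fun r => r) (fun a _ ih r => List.rec (motive := fun _ => List ℕ) (a :: ih []) (fun b t _ => Nat.lor a b :: ih t) r) l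
def mulL (x : ℕ) (l : List ℕ) : List ℕ := List.rec [] (fun a _ ih => Nat.land x a :: ih) l
def sumL (l : List ℕ) : List ℕ := List.rec [] (fun x r ih => x :: orL (mulL x r) (0 :: ih)) l
def difL (l : List ℕ) : List ℕ := List.rec [] (fun x r ih => orL (mulL x r) ih) l
def notL (M : ℕ) (l : List ℕ) (e : List ℕ) : List ℕ := List.rec e (fun a _ ih => Nat.xor M a :: ih) l
def appL (l : List ℕ) (e : List ℕ) : List ℕ := List.rec e (fun a _ ih => a :: ih) l
def carr : List ℕ → ℕ → List ℕ
  | [], _ => []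
  | [a], s => [Nat.land s a]
  | a :: b :: r, s => Nat.lor (Nat.land a b) (Nat.land s (Nat.xor a b)) :: carr r (Nat.xor s (Nat.xor a b))
def bitS (M a i : ℕ) : ℕ := Nat.mul M (Nat.mod (Nat.shiftRight a i) 2)
def bitsL (M a : ℕ) (k : ℕ) (e : List ℕ) : List ℕ :=
  Nat.rec (motive := fun _ => ℕ → List ℕ) (fun _ => e) (fun _ ih i => bitS M a i :: ih (Nat.succ i)) k 0
def varsL (F M : ℕ) (e : List ℕ) : List ℕ :=
  Nat.rec (motive := fun _ => ℕ → List ℕ) (fun _ => e) (fun _ ih i => Nat.xor M (blk F i) :: ih (Nat.succ i)) F 0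
def orAll (l : List ℕ) : ℕ := List.rec 0 (fun a _ ih => Nat.lor a ih) l
def slices (L F a b : ℕ) : List ℕ := bitsL (ones F) a L (varsL F (ones F) (bitsL (ones F) b L []))
def mstd (o M : ℕ) (xs : List ℕ) : ℕ :=
  orAll (carr (carr (carr (carr (carr (appL (carr (sumL xs) (bitS M o 0)) (notL M (difL xs) []))
    (bitS M o 1)) (bitS M o 2)) (bitS M o 3)) (bitS M o 4)) (bitS M o 5))
def swar (F j x : ℕ) : ℕ := Nat.add (Nat.land x (blk F j)) (Nat.land (Nat.shiftRight x (Nat.pow 2 j)) (blk F j))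
def pc (F x : ℕ) : ℕ := Nat.mod (swar F 4 (swar F 3 (swar F 2 (swar F 1 (swar F 0 x))))) 4294967295
def cls (L F a b : ℕ) : ℕ := pc F (mstd (Nat.sub 64 (Nat.mul 2 (Nat.add (Nat.mul 2 L) F))) (ones F) (slices L F a b))
def tot (L F : ℕ) (l : List (ℕ×ℕ)) : ℕ := List.rec 0 (fun a _ ih => Nat.add (cls L F a.1 a.2) ih) l

/-! ### Block masks and SWAR popcount -/
def mm (w : ℕ) : ℕ → ℕ
  | 0 => 0
  | k + 1 => 2 ^ (2 * w) * mm w k + (2 ^ w - 1)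

theorem mm_mul (w k : ℕ) : mm w k * (2 ^ w + 1) + 1 = 2 ^ (2 * w * k) := by
  induction k with
  | zero => simp [mm]
  | succ k ih =>
    have h1 : 2 ^ (2 * w * (k + 1)) = 2 ^ (2 * w) * 2 ^ (2 * w * k) := by rw [← pow_add]; ring_nf
    have h2 : 2 ^ (2 * w) = 2 ^ w * 2 ^ w := by rw [← pow_add]; ring_nf
    have h3 : 1 ≤ 2 ^ w := Nat.one_le_two_pow
    rw [h1, ← ih, mm, h2]
    generalize 2 ^ w = q at *
    obtain ⟨p, rfl⟩ : ∃ p, q = p + 1 := ⟨q - 1, by omega⟩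
    simp only [Nat.add_sub_cancel]
    ring

theorem blk_eq {F j : ℕ} (h : j < F) : blk F j = mm (2 ^ j) (2 ^ (F - 1 - j)) := by
  have h0 := mm_mul (2 ^ j) (2 ^ (F - 1 - j))
  have h1 : 2 * 2 ^ j * 2 ^ (F - 1 - j) = 2 ^ F := by
    rw [← pow_succ', ← pow_add]; congr 1; omega
  rw [h1] at h0
  change (2 ^ (2 ^ F) - 1) / (2 ^ (2 ^ j) + 1) = _
  rw [← h0, Nat.add_sub_cancel]
  exact Nat.mul_div_cancel _ (by positivity)

theorem testBit_mm (w : ℕ) (hw : 0 < w) (k i : ℕ) (hi : i < 2 * w * k) :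
    (mm w k).testBit i = decide ((i / w) % 2 = 0) := by
  induction k generalizing i with
  | zero => simp at hi
  | succ k ih =>
    have hlt : 2 ^ w - 1 < 2 ^ (2 * w) := by
      have : 2 ^ w ≤ 2 ^ (2 * w) := Nat.pow_le_pow_right (by norm_num) (by omega)
      have := Nat.one_le_two_pow (n := w)
      omega
    rw [mm, Nat.testBit_two_pow_mul_add _ hlt]
    split_ifs with h
    · rw [Nat.testBit_two_pow_sub_one]
      by_cases hiw : i < w
      · simp [hiw, Nat.div_eq_of_lt hiw]
      · have : i / w = 1 := by
          apply Nat.div_eq_of_lt_le <;> omega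
        simp [hiw, this]
    · rw [ih _ (by rw [mul_add] at hi; omega)]
      obtain ⟨t, rfl⟩ : ∃ t, i = t + w * 2 := ⟨i - w * 2, by omega⟩
      rw [Nat.add_mul_div_left _ _ hw]
      have : t + w * 2 - 2 * w = t := by omega
      rw [this]; simp

theorem testBit_blk {F j m : ℕ} (h : j < F) (hm : m < 2 ^ F) :
    (blk F j).testBit m = !(m.testBit j) := by
  have h1 : 2 * 2 ^ j * 2 ^ (F - 1 - j) = 2 ^ F := by
    rw [← pow_succ', ← pow_add]; congr 1; omega
  rw [blk_eq h, testBit_mm _ (by positivity) _ _ (by rw [h1]; exact hm), Nat.testBit_eq_decide_div_mod_eq]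
  rcases Nat.mod_two_eq_zero_or_one (m / 2 ^ j) with h | h <;> simp [h]

theorem testBit_ones {F m : ℕ} (hm : m < 2 ^ F) : (ones F).testBit m = true := by
  change (2 ^ (2 ^ F) - 1).testBit m = true
  rw [Nat.testBit_two_pow_sub_one]; simpa using hm

def ds (w : ℕ) : ℕ → ℕ → ℕ
  | 0, _ => 0
  | k + 1, x => x % 2 ^ w + ds w k (x / 2 ^ w)

def sw (w k x : ℕ) : ℕ := (x &&& mm w k) + ((x >>> w) &&& mm w k)

theorem land_mm (w k x : ℕ) :
    x &&& mm w (k + 1) = 2 ^ (2 * w) * ((x / 2 ^ (2 * w)) &&& mm w k) + x % 2 ^ w := by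
  have hlt : 2 ^ w - 1 < 2 ^ (2 * w) := by
    have : 2 ^ w ≤ 2 ^ (2 * w) := Nat.pow_le_pow_right (by norm_num) (by omega)
    have := Nat.one_le_two_pow (n := w)
    omega
  have hlt2 : x % 2 ^ w < 2 ^ (2 * w) := by
    have : 2 ^ w ≤ 2 ^ (2 * w) := Nat.pow_le_pow_right (by norm_num) (by omega)
    have := Nat.mod_lt x (Nat.two_pow_pos w)
    omega
  apply Nat.eq_of_testBit_eq
  intro i
  rw [Nat.testBit_land, mm, Nat.testBit_two_pow_mul_add _ hlt, Nat.testBit_two_pow_mul_add _ hlt2]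
  split_ifs with h
  · rw [Nat.testBit_two_pow_sub_one, Nat.testBit_mod_two_pow, Bool.and_comm]
  · rw [Nat.testBit_land, Nat.testBit_div_two_pow]
    congr 2; omega

theorem sw_succ (w k x : ℕ) : sw w (k + 1) x =
    2 ^ (2 * w) * sw w k (x / 2 ^ (2 * w)) + (x % 2 ^ w + x / 2 ^ w % 2 ^ w) := by
  unfold sw
  rw [land_mm, land_mm]
  simp only [Nat.shiftRight_eq_div_pow]
  have : x / 2 ^ w / 2 ^ (2 * w) = x / 2 ^ (2 * w) / 2 ^ w := by
    rw [Nat.div_div_eq_div_mul, Nat.div_div_eq_div_mul, mul_comm]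
  rw [this]; ring

theorem digit_lt {w : ℕ} (hw : 0 < w) (x : ℕ) : x % 2 ^ w + x / 2 ^ w % 2 ^ w < 2 ^ (2 * w) := by
  have h1 := Nat.mod_lt x (Nat.two_pow_pos w)
  have h2 := Nat.mod_lt (x / 2 ^ w) (Nat.two_pow_pos w)
  have h3 : 2 ^ (2 * w) = 2 ^ w * 2 ^ w := by rw [← pow_add]; ring_nf
  have h4 : 2 ≤ 2 ^ w := by
    calc 2 = 2 ^ 1 := rfl
      _ ≤ 2 ^ w := Nat.pow_le_pow_right (by norm_num) hw
  rw [h3]; nlinarith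

theorem ds_sw {w : ℕ} (hw : 0 < w) (k x : ℕ) : ds (2 * w) k (sw w k x) = ds w (2 * k) x := by
  induction k generalizing x with
  | zero => rfl
  | succ k ih =>
    have hd := digit_lt hw x
    rw [ds, sw_succ, Nat.mul_add_mod, Nat.mod_eq_of_lt hd, Nat.mul_add_div (by positivity),
      Nat.div_eq_of_lt hd, add_zero, ih]
    change _ = ds w (2 * k + 1 + 1) x
    rw [ds, ds, Nat.div_div_eq_div_mul, ← pow_add, ← two_mul]; ring

theorem sw_lt {w : ℕ} (hw : 0 < w) (k x : ℕ) : sw w k x < 2 ^ (2 * w * k) := by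
  induction k generalizing x with
  | zero => simp [sw, mm]
  | succ k ih =>
    have hd := digit_lt hw x
    rw [sw_succ, mul_add, mul_one, pow_add]
    have := ih (x / 2 ^ (2 * w))
    calc _ < 2 ^ (2 * w) * sw w k (x / 2 ^ (2 * w)) + 2 ^ (2 * w) := by omega
      _ = 2 ^ (2 * w) * (sw w k (x / 2 ^ (2 * w)) + 1) := by ring
      _ ≤ 2 ^ (2 * w) * 2 ^ (2 * w * k) := Nat.mul_le_mul_left _ this
      _ = _ := mul_comm _ _

theorem mod_le_ds (w k x : ℕ) (h : x < 2 ^ (w * k)) : x % (2 ^ w - 1) ≤ ds w k x := by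
  have key : x ≡ ds w k x [MOD (2 ^ w - 1)] := by
    induction k generalizing x with
    | zero => simp at h; subst h; rfl
    | succ k ih =>
      have h1 : x / 2 ^ w < 2 ^ (w * k) := by
        apply Nat.div_lt_of_lt_mul; rw [← pow_add]; convert h using 2; ring
      have h2 : 2 ^ w ≡ 1 [MOD (2 ^ w - 1)] := by
        have := Nat.one_le_two_pow (n := w)
        exact ((Nat.modEq_iff_dvd' this).2 dvd_rfl).symm
      calc x = x % 2 ^ w + 2 ^ w * (x / 2 ^ w) := (Nat.mod_add_div _ _).symm
        _ ≡ x % 2 ^ w + 1 * (x / 2 ^ w) [MOD (2 ^ w - 1)] := (h2.mul_right _).add_left _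
        _ ≡ ds w (k + 1) x [MOD (2 ^ w - 1)] := by
          rw [one_mul, ds]; exact (ih _ h1).add_left _
  rw [key]; exact Nat.mod_le _ _

theorem ds_one (k x : ℕ) : ds 1 k x = ((Finset.range k).filter (fun m => x.testBit m = true)).card := by
  rw [Finset.card_filter]
  induction k generalizing x with
  | zero => rfl
  | succ k ih =>
    rw [ds, Finset.sum_range_succ', ih, add_comm]
    simp only [pow_one, Nat.testBit_succ, Nat.testBit_zero]
    congr 1
    rcases Nat.mod_two_eq_zero_or_one x with h | h <;> simp [h]

theorem swar_eq {F j : ℕ} (h : j < F) (x : ℕ) : swar F j x = sw (2 ^ j) (2 ^ (F - 1 - j)) x := by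
  rw [sw, ← blk_eq h]; rfl

theorem ds_swar {F j : ℕ} (h : j < F) (x : ℕ) :
    ds (2 ^ (j + 1)) (2 ^ (F - (j + 1))) (swar F j x) = ds (2 ^ j) (2 ^ (F - j)) x := by
  rw [swar_eq h, pow_succ', show F - (j + 1) = F - 1 - j by omega, ds_sw (by positivity), ← pow_succ']
  congr 2; omega

theorem pc_le {F : ℕ} (hF : 5 ≤ F) (x : ℕ) :
    pc F x ≤ ((Finset.range (2 ^ F)).filter (fun m => x.testBit m = true)).card := by
  rw [← ds_one]
  have e : ds 1 (2 ^ F) x = ds (2 ^ 5) (2 ^ (F - 5))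
      (swar F 4 (swar F 3 (swar F 2 (swar F 1 (swar F 0 x))))) := by
    rw [ds_swar (j := 4) (by omega), ds_swar (j := 3) (by omega), ds_swar (j := 2) (by omega),
      ds_swar (j := 1) (by omega), ds_swar (j := 0) (by omega)]; rfl
  rw [e]
  refine mod_le_ds (2 ^ 5) _ _ ?_
  rw [swar_eq (by omega)]
  refine (sw_lt (by positivity) _ _).trans_eq ?_
  rw [show F - 1 - 4 = F - 5 by omega, ← pow_succ']

/-! ### Bit sliced semantics -/
def bt (m a : ℕ) : ℕ := (a.testBit m).toNat
def cnt (m : ℕ) (l : List ℕ) : ℕ := (l.map (bt m)).sum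

theorem orL_nil (r : List ℕ) : orL [] r = r := rfl
theorem orL_cons_nil (a : ℕ) (l : List ℕ) : orL (a :: l) [] = a :: orL l [] := rfl
theorem orL_cons_cons (a b : ℕ) (l r : List ℕ) : orL (a :: l) (b :: r) = (a ||| b) :: orL l r := rfl
theorem mulL_nil (x : ℕ) : mulL x [] = [] := rfl
theorem mulL_cons (x a : ℕ) (l : List ℕ) : mulL x (a :: l) = (x &&& a) :: mulL x l := rfl
theorem sumL_cons (x : ℕ) (l : List ℕ) : sumL (x :: l) = x :: orL (mulL x l) (0 :: sumL l) := rfl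
theorem difL_cons (x : ℕ) (l : List ℕ) : difL (x :: l) = orL (mulL x l) (difL l) := rfl

theorem orL_getD (l r : List ℕ) (k : ℕ) : (orL l r).getD k 0 = l.getD k 0 ||| r.getD k 0 := by
  induction l generalizing r k with
  | nil => simp [orL_nil]
  | cons a l ih =>
    cases r with
    | nil => cases k with
      | zero => simp [orL_cons_nil]
      | succ k => rw [orL_cons_nil]; simpa using ih [] k
    | cons b r => cases k with
      | zero => simp [orL_cons_cons]
      | succ k => rw [orL_cons_cons]; simpa using ih r k

theorem orL_length (l r : List ℕ) : (orL l r).length = max l.length r.length := by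
  induction l generalizing r with
  | nil => simp [orL_nil]
  | cons a l ih =>
    cases r with
    | nil => rw [orL_cons_nil]; simp [ih]
    | cons b r => rw [orL_cons_cons]; simp [ih]

theorem mulL_getD (x : ℕ) (l : List ℕ) (k : ℕ) : (mulL x l).getD k 0 = x &&& l.getD k 0 := by
  induction l generalizing k with
  | nil => simp [mulL_nil]
  | cons a l ih => cases k with
    | zero => simp [mulL_cons]
    | succ k => rw [mulL_cons]; simpa using ih k

theorem mulL_length (x : ℕ) (l : List ℕ) : (mulL x l).length = l.length := by
  induction l with
  | nil => rfl
  | cons a l ih => rw [mulL_cons]; simp [ih]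

theorem difL_length (l : List ℕ) : (difL l).length = l.length - 1 := by
  induction l with
  | nil => rfl
  | cons a l ih => rw [difL_cons, orL_length, mulL_length, ih]; simp

/-- the `i`-th entry of the list is set in slice position `m` -/
def on (m : ℕ) (l : List ℕ) (i : ℕ) : Prop := (l.getD i 0).testBit m = true

theorem sumL_sound (m : ℕ) (l : List ℕ) (k : ℕ) (h : on m (sumL l) k) :
    ∃ i j, on m l i ∧ on m l j ∧ i + j = k := by
  induction l generalizing k with
  | nil => simp [on, sumL] at h
  | cons x l ih =>
    rw [sumL_cons] at h
    cases k with
    | zero => exact ⟨0, 0, by simpa [on] using h, by simpa [on] using h, rfl⟩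
    | succ k =>
      simp only [on, List.getD_cons_succ, orL_getD, mulL_getD, Nat.testBit_lor, Nat.testBit_land,
        Bool.or_eq_true, Bool.and_eq_true] at h
      rcases h with ⟨h1, h2⟩ | h
      · exact ⟨0, k + 1, by simpa [on] using h1, by simpa [on] using h2, by omega⟩
      · cases k with
        | zero => simp at h
        | succ k =>
          obtain ⟨i, j, hi, hj, e⟩ := ih k (by simpa [on] using h)
          exact ⟨i + 1, j + 1, by simpa [on] using hi, by simpa [on] using hj, by omega⟩

theorem difL_complete (m : ℕ) (l : List ℕ) (i k : ℕ) (h1 : on m l i) (h2 : on m l (i + k + 1)) :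
    on m (difL l) k := by
  induction l generalizing i with
  | nil => simp [on] at h1
  | cons x l ih =>
    simp only [on, difL_cons, orL_getD, mulL_getD, Nat.testBit_lor, Nat.testBit_land,
        Bool.or_eq_true, Bool.and_eq_true]
    cases i with
    | zero =>
      left
      refine ⟨by simpa [on] using h1, ?_⟩
      rw [zero_add] at h2; simpa [on] using h2
    | succ i =>
      right
      refine ih i (by simpa [on] using h1) ?_
      rw [show i + 1 + k + 1 = (i + k + 1) + 1 by omega] at h2; simpa [on] using h2

theorem cnt_eq (m : ℕ) (l : List ℕ) :
    cnt m l = ((Finset.range l.length).filter (fun k => (l.getD k 0).testBit m = true)).card := by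
  rw [Finset.card_filter]
  induction l with
  | nil => rfl
  | cons a l ih =>
    rw [List.length_cons, Finset.sum_range_succ']
    simp only [List.getD_cons_succ, List.getD_cons_zero]
    rw [← ih, cnt, List.map_cons, List.sum_cons, add_comm, ← cnt, bt]
    cases a.testBit m <;> simp

theorem carr_le (m : ℕ) (l : List ℕ) (s : ℕ) : 2 * cnt m (carr l s) ≤ cnt m l + bt m s := by
  induction l, s using carr.induct with
  | case1 s => simp [carr, cnt]
  | case2 a s =>
    change 2 * cnt m [s &&& a] ≤ _
    simp only [cnt, bt, List.map_cons, List.map_nil, List.sum_cons, List.sum_nil, Nat.testBit_land]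
    cases a.testBit m <;> cases s.testBit m <;> simp
  | case3 a b r s ih =>
    have e : carr (a :: b :: r) s = (a &&& b ||| s &&& (a ^^^ b)) :: carr r (s ^^^ (a ^^^ b)) := rfl
    change 2 * cnt m (carr r (s ^^^ (a ^^^ b))) ≤ cnt m r + bt m (s ^^^ (a ^^^ b)) at ih
    rw [e]
    simp only [cnt, List.map_cons, List.sum_cons] at ih ⊢
    simp only [bt, Nat.testBit_land, Nat.testBit_lor, Nat.testBit_xor] at ih ⊢
    revert ih
    cases a.testBit m <;> cases s.testBit m <;> cases b.testBit m <;> simp <;> omega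

theorem orAll_pos (m : ℕ) (l : List ℕ) (h : (orAll l).testBit m = true) : 1 ≤ cnt m l := by
  induction l with
  | nil => simp [orAll] at h
  | cons a l ih =>
    have e : orAll (a :: l) = a ||| orAll l := rfl
    rw [e, Nat.testBit_lor, Bool.or_eq_true] at h
    simp only [cnt, List.map_cons, List.sum_cons]
    rcases h with h | h
    · simp [bt, h]
    · have := ih h; simp only [cnt] at this; omega

theorem notL_cnt (m M : ℕ) (hM : M.testBit m = true) (l : List ℕ) :
    cnt m (notL M l []) + cnt m l = l.length := by
  induction l with
  | nil => rfl
  | cons a l ih =>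
    have e : notL M (a :: l) [] = (M ^^^ a) :: notL M l [] := rfl
    rw [e]
    simp only [cnt, List.map_cons, List.sum_cons, List.length_cons, bt, Nat.testBit_xor, hM] at ih ⊢
    cases a.testBit m <;> simp <;> omega

theorem appL_cnt (m : ℕ) (l e : List ℕ) : cnt m (appL l e) = cnt m l + cnt m e := by
  induction l with
  | nil => simp [appL, cnt]
  | cons a l ih =>
    have e' : appL (a :: l) e = a :: appL l e := rfl
    rw [e']
    simp only [cnt, List.map_cons, List.sum_cons] at ih ⊢
    omega

theorem testBit_bitS (m M a i : ℕ) (hM : M.testBit m = true) :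
    (bitS M a i).testBit m = a.testBit i := by
  change (M * ((a >>> i) % 2)).testBit m = _
  have e : a.testBit i = decide ((a >>> i) % 2 = 1) := by
    rw [Nat.testBit_eq_decide_div_mod_eq, Nat.shiftRight_eq_div_pow]
  rw [e]
  rcases Nat.mod_two_eq_zero_or_one (a >>> i) with h | h <;> simp [h, hM]

theorem mstd_sound (m o M : ℕ) (xs : List ℕ) (hM : M.testBit m = true) (ho : o < 64)
    (h : (mstd o M xs).testBit m = true) :
    64 ≤ cnt m (sumL xs) + o + 2 * (xs.length - 1 - cnt m (difL xs)) := by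
  have h0 := orAll_pos _ _ h
  have c0 := carr_le m (sumL xs) (bitS M o 0)
  have c1 := carr_le m (appL (carr (sumL xs) (bitS M o 0)) (notL M (difL xs) [])) (bitS M o 1)
  rw [appL_cnt] at c1
  have hn := notL_cnt m M hM (difL xs)
  rw [difL_length] at hn
  generalize hC1 : carr (appL (carr (sumL xs) (bitS M o 0)) (notL M (difL xs) [])) (bitS M o 1) = C1 at *
  have c2 := carr_le m C1 (bitS M o 2)
  generalize carr C1 (bitS M o 2) = C2 at *
  have c3 := carr_le m C2 (bitS M o 3)
  generalize carr C2 (bitS M o 3) = C3 at *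
  have c4 := carr_le m C3 (bitS M o 4)
  generalize carr C3 (bitS M o 4) = C4 at *
  have c5 := carr_le m C4 (bitS M o 5)
  generalize carr C4 (bitS M o 5) = C5 at *
  simp only [bt, testBit_bitS _ _ _ _ hM] at c0 c1 c2 c3 c4 c5
  have ob : (o.testBit 0).toNat + 2 * (o.testBit 1).toNat + 4 * (o.testBit 2).toNat
      + 8 * (o.testBit 3).toNat + 16 * (o.testBit 4).toNat + 32 * (o.testBit 5).toNat = o := by
    clear * - ho
    interval_cases o <;> rfl
  omega

/-! ### From slices to sets -/
def gen (f : ℕ → ℕ) (e : List ℕ) (k : ℕ) : ℕ → List ℕ :=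
  Nat.rec (motive := fun _ => ℕ → List ℕ) (fun _ => e) (fun _ ih i => f i :: ih (Nat.succ i)) k

theorem gen_getD (f : ℕ → ℕ) (e : List ℕ) (k i0 i : ℕ) :
    (gen f e k i0).getD i 0 = if i < k then f (i0 + i) else e.getD (i - k) 0 := by
  induction k generalizing i0 i with
  | zero => simp [gen]
  | succ k ih =>
    have e' : gen f e (k + 1) i0 = f i0 :: gen f e k (i0 + 1) := rfl
    rw [e']
    cases i with
    | zero => simp
    | succ i =>
      rw [List.getD_cons_succ, ih]
      simp only [Nat.add_lt_add_iff_right, Nat.add_sub_add_right]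
      rw [show i0 + 1 + i = i0 + (i + 1) by omega]

theorem gen_length (f : ℕ → ℕ) (e : List ℕ) (k i0 : ℕ) :
    (gen f e k i0).length = k + e.length := by
  induction k generalizing i0 with
  | zero => simp [gen]
  | succ k ih =>
    have e' : gen f e (k + 1) i0 = f i0 :: gen f e k (i0 + 1) := rfl
    rw [e', List.length_cons, ih]; omega

theorem slices_eq (L F a b : ℕ) : slices L F a b =
    gen (bitS (ones F) a) (gen (fun i => ones F ^^^ blk F i) (gen (bitS (ones F) b) [] L 0) F 0) L 0 := rfl

theorem slices_length (L F a b : ℕ) : (slices L F a b).length = 2 * L + F := by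
  rw [slices_eq, gen_length, gen_length, gen_length]; simp; omega

/-- the integer encoding the set with fringes `a`, `b` and middle part `m` -/
def enc (L F : ℕ) (p : ℕ × ℕ) (m : ℕ) : ℕ := 2 ^ (L + F) * p.2 + (2 ^ L * m + p.1)

theorem enc_low {L F : ℕ} {p : ℕ × ℕ} {m : ℕ} (ha : p.1 < 2 ^ L) (hm : m < 2 ^ F) :
    2 ^ L * m + p.1 < 2 ^ (L + F) := by
  rw [pow_add]
  calc _ < 2 ^ L * m + 2 ^ L := by omega
    _ = 2 ^ L * (m + 1) := by ring
    _ ≤ _ := Nat.mul_le_mul_left _ hm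

theorem enc_testBit {L F : ℕ} {p : ℕ × ℕ} {m : ℕ} (ha : p.1 < 2 ^ L) (hm : m < 2 ^ F) (i : ℕ) :
    (enc L F p m).testBit i = if i < L + F then (if i < L then p.1.testBit i else m.testBit (i - L))
      else p.2.testBit (i - (L + F)) := by
  rw [enc, Nat.testBit_two_pow_mul_add _ (enc_low ha hm), Nat.testBit_two_pow_mul_add _ ha]

theorem slices_on {L F : ℕ} {p : ℕ × ℕ} {m : ℕ} (ha : p.1 < 2 ^ L) (hb : p.2 < 2 ^ L)
    (hm : m < 2 ^ F) (i : ℕ) :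
    on m (slices L F p.1 p.2) i ↔ (enc L F p m).testBit i = true := by
  rw [enc_testBit ha hm, on, slices_eq, gen_getD, gen_getD, gen_getD]
  have hM := testBit_ones hm
  by_cases h1 : i < L
  · rw [if_pos h1, if_pos (by omega), if_pos h1, testBit_bitS _ _ _ _ hM, zero_add]
  · rw [if_neg h1, if_neg h1]
    by_cases h2 : i < L + F
    · rw [if_pos (show i - L < F by omega), if_pos h2, Nat.testBit_xor, hM,
        testBit_blk (by omega) hm]
      simp
    · rw [if_neg (show ¬ i - L < F by omega), if_neg h2]
      by_cases h3 : i - L - F < L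
      · rw [if_pos h3, testBit_bitS _ _ _ _ hM, zero_add, Nat.sub_sub]
      · rw [if_neg h3]
        have : p.2 < 2 ^ (i - (L + F)) :=
          hb.trans_le (Nat.pow_le_pow_right (by norm_num) (by omega))
        simp [Nat.testBit_lt_two_pow this]

def st (x : ℕ) : Finset ℤ := ((Finset.range 30).filter (fun i => x.testBit i = true)).image (fun i : ℕ => (i : ℤ))

theorem mem_st (x : ℕ) (z : ℤ) : z ∈ st x ↔ ∃ i : ℕ, i < 30 ∧ x.testBit i = true ∧ (i : ℤ) = z := by
  simp [st, and_assoc]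

def MQ (A : Finset ℤ) : Prop := (A - A).card < (A + A).card

instance : DecidablePred MQ := fun A => inferInstanceAs (Decidable ((A - A).card < (A + A).card))

theorem lt_of_on {m : ℕ} {l : List ℕ} {i : ℕ} (h : on m l i) : i < l.length := by
  by_contra hh
  rw [on, List.getD_eq_default _ _ (by omega)] at h
  simp at h

theorem class_sound {L F : ℕ} (hn : 2 * L + F ≤ 30) (hn1 : 1 ≤ 2 * L + F) {p : ℕ × ℕ} {m : ℕ}
    (ha : p.1 < 2 ^ L) (hb : p.2 < 2 ^ L) (hm : m < 2 ^ F)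
    (h : (mstd (64 - 2 * (2 * L + F)) (ones F) (slices L F p.1 p.2)).testBit m = true) :
    MQ (st (enc L F p m)) := by
  have hon := slices_on ha hb hm
  have key := mstd_sound m _ _ _ (testBit_ones hm) (by omega) h
  have hlen := slices_length L F p.1 p.2
  generalize slices L F p.1 p.2 = xs at *
  generalize enc L F p m = x at *
  have hmem : ∀ i, on m xs i → (i : ℤ) ∈ st x := fun i hi =>
    (mem_st _ _).2 ⟨i, by have := lt_of_on hi; omega, (hon i).1 hi, rfl⟩
  have h1 : cnt m (sumL xs) ≤ (st x + st x).card := by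
    rw [cnt_eq]
    refine Finset.card_le_card_of_injOn (fun k : ℕ => (k : ℤ)) ?_ ?_
    · intro k hk
      have hk' := (Finset.mem_filter.1 (Finset.mem_coe.1 hk)).2
      obtain ⟨i, j, hi, hj, e⟩ := sumL_sound m xs k hk'
      simp only [Finset.coe_add, ← e]
      push_cast
      exact Set.add_mem_add (hmem i hi) (hmem j hj)
    · intro a _ b _ e; simpa using e
  have h2 : (st x - st x).card ≤ 1 + 2 * cnt m (difL xs) := by
    rw [cnt_eq]
    set K := (Finset.range (difL xs).length).filter (fun k => ((difL xs).getD k 0).testBit m = true)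
    have hsub : st x - st x ⊆ insert 0 (K.image (fun k : ℕ => (k : ℤ) + 1) ∪ K.image (fun k : ℕ => -((k : ℤ) + 1))) := by
      intro z hz
      obtain ⟨u, hu, v, hv, rfl⟩ := Finset.mem_sub.1 hz
      obtain ⟨i, -, hi, rfl⟩ := (mem_st _ _).1 hu
      obtain ⟨j, -, hj, rfl⟩ := (mem_st _ _).1 hv
      have hK : ∀ k, on m (difL xs) k → k ∈ K := fun k hk =>
        Finset.mem_filter.2 ⟨Finset.mem_range.2 (lt_of_on hk), hk⟩
      rw [Finset.mem_insert, Finset.mem_union, Finset.mem_image, Finset.mem_image]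
      rcases lt_trichotomy i j with hij | hij | hij
      · right; right
        obtain ⟨k, rfl⟩ : ∃ k, j = i + k + 1 := ⟨j - i - 1, by omega⟩
        refine ⟨k, hK k (difL_complete m xs i k ((hon _).2 hi) ((hon _).2 hj)), ?_⟩
        push_cast; ring
      · left; subst hij; ring
      · right; left
        obtain ⟨k, rfl⟩ : ∃ k, i = j + k + 1 := ⟨i - j - 1, by omega⟩
        refine ⟨k, hK k (difL_complete m xs j k ((hon _).2 hj) ((hon _).2 hi)), ?_⟩
        push_cast; ring
    have := Finset.card_le_card hsub
    have i1 := Finset.card_insert_le (0 : ℤ) (K.image (fun k : ℕ => (k : ℤ) + 1) ∪ K.image (fun k : ℕ => -((k : ℤ) + 1)))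
    have i2 := Finset.card_union_le (K.image (fun k : ℕ => (k : ℤ) + 1)) (K.image (fun k : ℕ => -((k : ℤ) + 1)))
    have i3 := Finset.card_image_le (s := K) (f := fun k : ℕ => (k : ℤ) + 1)
    have i4 := Finset.card_image_le (s := K) (f := fun k : ℕ => -((k : ℤ) + 1))
    omega
  have h3 : cnt m (difL xs) ≤ xs.length - 1 := by
    rw [cnt_eq, ← difL_length]
    exact (Finset.card_filter_le _ _).trans (by simp)
  unfold MQ
  omega

/-- number of sum-dominant sets in a class -/
def cc (L F : ℕ) (p : ℕ × ℕ) : ℕ :=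
  ((Finset.range (2 ^ F)).filter (fun m => MQ (st (enc L F p m)))).card

theorem cls_le {L F : ℕ} (hF : 5 ≤ F) (hn : 2 * L + F ≤ 30) {p : ℕ × ℕ}
    (ha : p.1 < 2 ^ L) (hb : p.2 < 2 ^ L) : cls L F p.1 p.2 ≤ cc L F p := by
  refine (pc_le hF _).trans (Finset.card_le_card ?_)
  intro m hm
  rw [Finset.mem_filter, Finset.mem_range] at hm
  exact Finset.mem_filter.2 ⟨Finset.mem_range.2 hm.1, class_sound hn (by omega) ha hb hm.1 hm.2⟩

/-! ### Symmetries -/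
theorem MQ_affine (c s : ℤ) (hs : s ≠ 0) (A : Finset ℤ) (h : MQ A) :
    MQ (A.image (fun z => c + s * z)) := by
  have e1 : A.image (fun z => c + s * z) + A.image (fun z => c + s * z)
      = (A + A).image (fun z => (c + c) + s * z) := by
    ext z
    simp only [Finset.mem_add, Finset.mem_image]
    constructor
    · rintro ⟨_, ⟨u, hu, rfl⟩, _, ⟨v, hv, rfl⟩, rfl⟩
      exact ⟨u + v, ⟨u, hu, v, hv, rfl⟩, by ring⟩
    · rintro ⟨_, ⟨u, hu, v, hv, rfl⟩, rfl⟩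
      exact ⟨_, ⟨u, hu, rfl⟩, _, ⟨v, hv, rfl⟩, by ring⟩
  have e2 : A.image (fun z => c + s * z) - A.image (fun z => c + s * z)
      = (A - A).image (fun z => s * z) := by
    ext z
    simp only [Finset.mem_sub, Finset.mem_image]
    constructor
    · rintro ⟨_, ⟨u, hu, rfl⟩, _, ⟨v, hv, rfl⟩, rfl⟩
      exact ⟨u - v, ⟨u, hu, v, hv, rfl⟩, by ring⟩
    · rintro ⟨_, ⟨u, hu, v, hv, rfl⟩, rfl⟩
      exact ⟨_, ⟨u, hu, rfl⟩, _, ⟨v, hv, rfl⟩, by ring⟩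
  unfold MQ at h ⊢
  rw [e1, e2, Finset.card_image_of_injective, Finset.card_image_of_injective]
  · exact h
  · intro a b hab; simpa [hs] using hab
  · intro a b hab; simpa [hs] using hab

theorem lt_of_testBit {x n i : ℕ} (hx : x < 2 ^ n) (h : x.testBit i = true) : i < n := by
  by_contra hh
  rw [Nat.testBit_lt_two_pow (hx.trans_le (Nat.pow_le_pow_right (by norm_num) (by omega)))] at h
  simp at h

theorem st_double {x : ℕ} (hx : x < 2 ^ 29) : st (2 * x) = (st x).image (fun z => 1 + 1 * z) := by
  ext z
  simp only [mem_st, Finset.mem_image]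
  constructor
  · rintro ⟨i, hi, h, rfl⟩
    cases i with
    | zero => simp at h
    | succ i =>
      rw [Nat.testBit_succ, Nat.mul_div_cancel_left _ (by norm_num)] at h
      exact ⟨i, ⟨i, by omega, h, rfl⟩, by push_cast; ring⟩
  · rintro ⟨_, ⟨i, hi, h, rfl⟩, rfl⟩
    have := lt_of_testBit hx h
    refine ⟨i + 1, by omega, ?_, by push_cast; ring⟩
    rw [Nat.testBit_succ, Nat.mul_div_cancel_left _ (by norm_num)]; exact h

/-- reversal of `k` bits -/
def rv : ℕ → ℕ → ℕ
  | 0, _ => 0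
  | k + 1, x => 2 ^ k * (x % 2) + rv k (x / 2)

theorem rv_lt (k x : ℕ) : rv k x < 2 ^ k := by
  induction k generalizing x with
  | zero => simp [rv]
  | succ k ih =>
    have := ih (x / 2)
    rw [rv, pow_succ]
    rcases Nat.mod_two_eq_zero_or_one x with h | h <;> rw [h] <;> omega

theorem rv_testBit (k x i : ℕ) : (rv k x).testBit i = (decide (i < k) && x.testBit (k - 1 - i)) := by
  induction k generalizing x i with
  | zero => simp [rv]
  | succ k ih =>
    rw [rv, Nat.testBit_two_pow_mul_add _ (rv_lt _ _), ih]
    split_ifs with h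
    · have e : k + 1 - 1 - i = (k - 1 - i) + 1 := by omega
      rw [e, Nat.testBit_succ]
      simp [h, show i < k + 1 by omega]
    · by_cases h2 : i = k
      · subst h2; simp [Nat.testBit_zero]
      · obtain ⟨t, rfl⟩ : ∃ t, i = k + t + 1 := ⟨i - k - 1, by omega⟩
        have e : k + t + 1 - k = t + 1 := by omega
        rw [e, Nat.testBit_succ]
        have : x % 2 / 2 = 0 := by omega
        simp [this]

theorem rv_rv {n x : ℕ} (hx : x < 2 ^ n) : rv n (rv n x) = x := by
  apply Nat.eq_of_testBit_eq
  intro i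
  rw [rv_testBit, rv_testBit]
  by_cases h : i < n
  · have e : n - 1 - (n - 1 - i) = i := by omega
    rw [e]
    simp only [h, show n - 1 - i < n by omega, decide_true, Bool.true_and]
  · have : x.testBit i = false :=
      Nat.testBit_lt_two_pow (hx.trans_le (Nat.pow_le_pow_right (by norm_num) (by omega)))
    simp [h, this]

theorem st_rv {n x : ℕ} (hn : n ≤ 30) (hx : x < 2 ^ n) :
    st (rv n x) = (st x).image (fun z => ((n : ℤ) - 1) + (-1) * z) := by
  ext z
  simp only [mem_st, Finset.mem_image, rv_testBit, Bool.and_eq_true, decide_eq_true_eq]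
  constructor
  · rintro ⟨i, hi, ⟨h1, h⟩, rfl⟩
    exact ⟨_, ⟨n - 1 - i, by omega, h, rfl⟩, by omega⟩
  · rintro ⟨_, ⟨i, hi, h, rfl⟩, rfl⟩
    have := lt_of_testBit hx h
    refine ⟨n - 1 - i, by omega, ⟨by omega, ?_⟩, by omega⟩
    rw [show n - 1 - (n - 1 - i) = i by omega]; exact h

/-! ### Counting -/
def setF (n : ℕ) : Finset ℕ := (Finset.range (2 ^ n)).filter (fun x => MQ (st x))
def setH (n : ℕ) : Finset ℕ := (Finset.range (2 ^ n)).filter (fun x => x % 2 = 1 ∧ MQ (st x))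
def setG (n : ℕ) : Finset ℕ := (Finset.range (2 ^ n)).filter
  (fun x => x % 2 = 1 ∧ 2 ^ (n - 1) ≤ x ∧ MQ (st x))

theorem card_F (n : ℕ) (hn : n < 30) : (setF n).card + (setH (n + 1)).card ≤ (setF (n + 1)).card := by
  rw [← Finset.card_image_of_injective (setF n) (f := fun x => 2 * x)
    (fun a b h => by simpa using h), ← Finset.card_union_of_disjoint]
  · apply Finset.card_le_card
    intro x hx
    rw [Finset.mem_union, Finset.mem_image] at hx
    rcases hx with ⟨y, hy, rfl⟩ | hx
    · rw [setF, Finset.mem_filter, Finset.mem_range] at hy ⊢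
      refine ⟨by rw [pow_succ]; omega, ?_⟩
      rw [st_double (hy.1.trans_le (Nat.pow_le_pow_right (by norm_num) (by omega)))]
      exact MQ_affine _ _ (by norm_num) _ hy.2
    · rw [setH, Finset.mem_filter] at hx
      exact Finset.mem_filter.2 ⟨hx.1, hx.2.2⟩
  · rw [Finset.disjoint_left]
    intro x hx hx'
    obtain ⟨y, -, rfl⟩ := Finset.mem_image.1 hx
    have := (Finset.mem_filter.1 hx').2.1
    omega

theorem card_H (n : ℕ) : (setH n).card + (setG (n + 1)).card ≤ (setH (n + 1)).card := by
  rw [← Finset.card_union_of_disjoint]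
  · apply Finset.card_le_card
    intro x hx
    rw [Finset.mem_union, setH, setG, Finset.mem_filter, Finset.mem_filter, Finset.mem_range] at hx
    rw [setH, Finset.mem_filter, Finset.mem_range]
    rcases hx with hx | hx
    · exact ⟨by rw [pow_succ]; omega, hx.2⟩
    · exact ⟨Finset.mem_range.1 hx.1, hx.2.1, hx.2.2.2⟩
  · rw [Finset.disjoint_left]
    intro x hx hx'
    have h1 := Finset.mem_range.1 (Finset.mem_filter.1 hx).1
    have h2 := (Finset.mem_filter.1 hx').2.2.1
    simp only [Nat.add_sub_cancel] at h2
    omega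

theorem enc_mod {L F : ℕ} {p : ℕ × ℕ} {m : ℕ} (ha : p.1 < 2 ^ L) : enc L F p m % 2 ^ L = p.1 := by
  rw [enc, pow_add, mul_assoc, ← add_assoc, ← mul_add, Nat.mul_add_mod, Nat.mod_eq_of_lt ha]

theorem enc_inj {L F : ℕ} {p q : ℕ × ℕ} {m k : ℕ} (ha : p.1 < 2 ^ L) (hm : m < 2 ^ F)
    (hc : q.1 < 2 ^ L) (hk : k < 2 ^ F) (h : enc L F p m = enc L F q k) : p = q ∧ m = k := by
  have e1 : p.1 = q.1 := by rw [← enc_mod (F := F) (m := m) ha, h, enc_mod hc]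
  have l1 := enc_low ha hm
  have l2 := enc_low hc hk
  have e2 : p.2 = q.2 := by
    have h' := congrArg (· / 2 ^ (L + F)) h
    simp only [enc] at h'
    rw [Nat.mul_add_div (by positivity), Nat.mul_add_div (by positivity),
      Nat.div_eq_of_lt l1, Nat.div_eq_of_lt l2] at h'
    simpa using h'
  refine ⟨Prod.ext e1 e2, ?_⟩
  rw [enc, enc, e1, e2] at h
  have : 2 ^ L * m = 2 ^ L * k := by omega
  exact Nat.eq_of_mul_eq_mul_left (by positivity) this

theorem enc_rv {L F : ℕ} {p : ℕ × ℕ} {m : ℕ} (ha : p.1 < 2 ^ L) (hm : m < 2 ^ F) :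
    rv (2 * L + F) (enc L F p m) % 2 ^ L = rv L p.2 := by
  apply Nat.eq_of_testBit_eq
  intro i
  rw [Nat.testBit_mod_two_pow, rv_testBit, rv_testBit, enc_testBit ha hm]
  by_cases h : i < L
  · rw [if_neg (by omega)]
    simp only [h, decide_true, Bool.true_and, show i < 2 * L + F by omega]
    congr 1; omega
  · simp [h]

/-- fringe pairs admissible for the set decompositions -/
def good (L : ℕ) (p : ℕ × ℕ) : Prop := p.1 < 2 ^ L ∧ p.2 < 2 ^ L ∧ p.1 % 2 = 1 ∧ 2 ^ (L - 1) ≤ p.2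

def setS (L F : ℕ) (l : List (ℕ × ℕ)) : Finset ℕ :=
  l.toFinset.biUnion (fun p => ((Finset.range (2 ^ F)).filter (fun m => MQ (st (enc L F p m)))).image (enc L F p))

theorem mem_setS (L F : ℕ) (l : List (ℕ × ℕ)) (x : ℕ) (hx : x ∈ setS L F l) :
    ∃ p ∈ l, ∃ m < 2 ^ F, MQ (st (enc L F p m)) ∧ enc L F p m = x := by
  simp only [setS, Finset.mem_biUnion, List.mem_toFinset, Finset.mem_image, Finset.mem_filter,
    Finset.mem_range] at hx
  obtain ⟨p, hp, m, ⟨h1, h2⟩, h3⟩ := hx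
  exact ⟨p, hp, m, h1, h2, h3⟩

theorem tot_cons (L F : ℕ) (p : ℕ × ℕ) (l : List (ℕ × ℕ)) :
    tot L F (p :: l) = cls L F p.1 p.2 + tot L F l := rfl

theorem tot_append (L F : ℕ) (l r : List (ℕ × ℕ)) : tot L F (l ++ r) = tot L F l + tot L F r := by
  induction l with
  | nil => simp [tot]
  | cons p l ih => rw [List.cons_append, tot_cons, tot_cons, ih, add_assoc]

theorem tot_le {L F : ℕ} (hF : 5 ≤ F) (hn : 2 * L + F ≤ 30) (l : List (ℕ × ℕ))
    (hl : ∀ p ∈ l, good L p) (hd : l.Nodup) : tot L F l ≤ (setS L F l).card := by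
  have h1 : tot L F l ≤ (l.map (cc L F)).sum := by
    clear hd
    induction l with
    | nil => simp [tot]
    | cons p l ih =>
      rw [tot_cons, List.map_cons, List.sum_cons]
      have hp := hl p (by simp)
      exact Nat.add_le_add (cls_le hF hn hp.1 hp.2.1) (ih (fun q hq => hl q (by simp [hq])))
  refine h1.trans_eq ?_
  rw [setS, Finset.card_biUnion, ← List.sum_toFinset _ hd]
  · apply Finset.sum_congr rfl
    intro p hp
    rw [Finset.card_image_of_injOn]
    · rfl
    · intro a ha b hb h
      have hp' := hl p (List.mem_toFinset.1 hp)
      rw [Finset.mem_coe, Finset.mem_filter, Finset.mem_range] at ha hb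
      exact (enc_inj hp'.1 ha.1 hp'.1 hb.1 h).2
  · intro p hp q hq hpq
    change Disjoint (Finset.image _ _) (Finset.image _ _)
    rw [Finset.disjoint_left]
    intro x hx hy
    obtain ⟨a, ha, rfl⟩ := Finset.mem_image.1 hx
    obtain ⟨b, hb, h⟩ := Finset.mem_image.1 hy
    rw [Finset.mem_filter, Finset.mem_range] at ha hb
    exact hpq (enc_inj (hl q (List.mem_toFinset.1 (Finset.mem_coe.1 hq))).1 hb.1 (hl p (List.mem_toFinset.1 hp)).1 ha.1 h).1.symm

theorem setS_sub {L F : ℕ} (hL : 1 ≤ L) (l : List (ℕ × ℕ))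
    (hl : ∀ p ∈ l, good L p) (x : ℕ) (hx : x ∈ setS L F l) : x ∈ setG (2 * L + F) := by
  obtain ⟨p, hp, m, hm, hq, rfl⟩ := mem_setS _ _ _ _ hx
  obtain ⟨h1, h2, h3, h4⟩ := hl p hp
  have hlow := enc_low h1 hm
  rw [setG, Finset.mem_filter, Finset.mem_range]
  refine ⟨?_, ?_, ?_, hq⟩
  · rw [enc, show 2 * L + F = (L + F) + L by omega, pow_add _ (L + F) L]
    calc _ < 2 ^ (L + F) * p.2 + 2 ^ (L + F) := by omega
      _ = 2 ^ (L + F) * (p.2 + 1) := by ring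
      _ ≤ _ := Nat.mul_le_mul_left _ h2
  · have := enc_mod (F := F) (m := m) h1
    rw [← this, Nat.mod_mod_of_dvd _ (dvd_pow_self 2 (by omega))] at h3
    exact h3
  · rw [enc, show 2 * L + F - 1 = (L + F) + (L - 1) by omega, pow_add _ (L + F) (L - 1)]
    exact (Nat.mul_le_mul_left _ h4).trans (Nat.le_add_right _ _)

theorem rv_setG {n : ℕ} (hn : n ≤ 30) (hn1 : 1 ≤ n) {x : ℕ} (hx : x ∈ setG n) : rv n x ∈ setG n := by
  rw [setG, Finset.mem_filter, Finset.mem_range] at hx ⊢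
  obtain ⟨h1, h2, h3, h4⟩ := hx
  refine ⟨rv_lt _ _, ?_, ?_, ?_⟩
  · have hb : x.testBit (n - 1) = true := by
      rw [Nat.testBit_eq_decide_div_mod_eq]
      have : x / 2 ^ (n - 1) = 1 := by
        apply Nat.div_eq_of_lt_le
        · omega
        · rw [← pow_succ']; rwa [show n - 1 + 1 = n by omega]
      simp [this]
    have := rv_testBit n x 0
    rw [Nat.testBit_zero, Nat.sub_zero, hb] at this
    simpa [show 0 < n by omega] using this
  · apply Nat.ge_two_pow_of_testBit
    rw [rv_testBit]
    simp [Nat.testBit_zero, h2]; omega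
  · rw [st_rv hn h1]; exact MQ_affine _ _ (by norm_num) _ h4

theorem card_G {L F : ℕ} (hL : 1 ≤ L) (hF : 5 ≤ F) (hn : 2 * L + F ≤ 30) (l e : List (ℕ × ℕ))
    (hl : ∀ p ∈ l, good L p ∧ p.1 < rv L p.2) (hld : l.Nodup)
    (he : ∀ p ∈ e, good L p ∧ p.1 = rv L p.2) (hed : e.Nodup) :
    2 * tot L F l + tot L F e ≤ (setG (2 * L + F)).card := by
  have t1 := tot_le hF hn l (fun p hp => (hl p hp).1) hld
  have t2 := tot_le hF hn e (fun p hp => (he p hp).1) hed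
  have hlt : ∀ x ∈ setG (2 * L + F), x < 2 ^ (2 * L + F) := fun x hx =>
    Finset.mem_range.1 (Finset.mem_filter.1 hx).1
  have s1 := setS_sub (F := F) hL l (fun p hp => (hl p hp).1)
  have s2 := setS_sub (F := F) hL e (fun p hp => (he p hp).1)
  have k1 : ∀ x ∈ setS L F l, x % 2 ^ L < rv (2 * L + F) x % 2 ^ L := by
    intro x hx
    obtain ⟨p, hp, m, hm, hq, rfl⟩ := mem_setS _ _ _ _ hx
    rw [enc_mod (hl p hp).1.1, enc_rv (hl p hp).1.1 hm]; exact (hl p hp).2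
  have k2 : ∀ x ∈ setS L F e, x % 2 ^ L = rv (2 * L + F) x % 2 ^ L := by
    intro x hx
    obtain ⟨p, hp, m, hm, hq, rfl⟩ := mem_setS _ _ _ _ hx
    rw [enc_mod (he p hp).1.1, enc_rv (he p hp).1.1 hm]; exact (he p hp).2
  have c3 : ((setS L F l).image (rv (2 * L + F))).card = (setS L F l).card := by
    apply Finset.card_image_of_injOn
    intro a ha b hb h
    rw [← rv_rv (hlt a (s1 a ha)), ← rv_rv (hlt b (s1 b hb))]
    exact congrArg _ h
  have k3 : ∀ x ∈ (setS L F l).image (rv (2 * L + F)), rv (2 * L + F) x % 2 ^ L < x % 2 ^ L := by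
    intro x hx
    obtain ⟨y, hy, rfl⟩ := Finset.mem_image.1 hx
    rw [rv_rv (hlt y (s1 y hy))]; exact k1 y hy
  have d1 : Disjoint (setS L F l) ((setS L F l).image (rv (2 * L + F))) := by
    rw [Finset.disjoint_left]; intro x h1 h2
    have := k1 x h1; have := k3 x h2; omega
  have d2 : Disjoint (setS L F l ∪ (setS L F l).image (rv (2 * L + F))) (setS L F e) := by
    rw [Finset.disjoint_left]; intro x h1 h2
    have := k2 x h2
    rcases Finset.mem_union.1 h1 with h1 | h1
    · have := k1 x h1; omega
    · have := k3 x h1; omega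
  have hc := Finset.card_union_of_disjoint d2
  rw [Finset.card_union_of_disjoint d1, c3] at hc
  have hs : (setS L F l ∪ (setS L F l).image (rv (2 * L + F))) ∪ setS L F e ⊆ setG (2 * L + F) := by
    intro x hx
    rcases Finset.mem_union.1 hx with hx | hx
    · rcases Finset.mem_union.1 hx with hx | hx
      · exact s1 x hx
      · obtain ⟨y, hy, rfl⟩ := Finset.mem_image.1 hx
        exact rv_setG hn (by omega) (s1 y hy)
    · exact s2 x hx
  have := Finset.card_le_card hs
  omega

/-- admissibility and strict monotonicity test for a list of fringe pairs -/
def chk (L : ℕ) (t : Bool) : List (ℕ × ℕ) → ℕ → Bool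
  | [], _ => true
  | p :: r, lo => Nat.ble lo (p.1 * 2 ^ L + p.2) && (Nat.blt p.1 (2 ^ L) && (Nat.blt p.2 (2 ^ L) &&
      (Nat.beq (p.1 % 2) 1 && (Nat.ble (2 ^ (L - 1)) p.2 &&
      ((bif t then Nat.blt p.1 (rv L p.2) else Nat.beq p.1 (rv L p.2)) &&
      chk L t r (p.1 * 2 ^ L + p.2 + 1))))))

theorem chk_sound (L : ℕ) (t : Bool) (l : List (ℕ × ℕ)) (lo : ℕ) (h : chk L t l lo = true) :
    l.Nodup ∧ ∀ p ∈ l, good L p ∧ (if t then p.1 < rv L p.2 else p.1 = rv L p.2) ∧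
      lo ≤ p.1 * 2 ^ L + p.2 := by
  induction l generalizing lo with
  | nil => simp
  | cons p r ih =>
    simp only [chk, Bool.and_eq_true, Nat.ble_eq, Nat.blt_eq, Nat.beq_eq] at h
    obtain ⟨h1, h2, h3, h4, h5, h6, h7⟩ := h
    obtain ⟨i1, i2⟩ := ih _ h7
    refine ⟨List.nodup_cons.2 ⟨fun hp => ?_, i1⟩, ?_⟩
    · have := (i2 p hp).2.2; omega
    · intro q hq
      rcases List.mem_cons.1 hq with rfl | hq
      · refine ⟨⟨h2, h3, h4, h5⟩, ?_, h1⟩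
        cases t <;> simpa using h6
      · obtain ⟨j1, j2, j3⟩ := i2 q hq
        exact ⟨j1, j2, by omega⟩

theorem card_G' {L F : ℕ} (l e : List (ℕ × ℕ)) (hL : 1 ≤ L) (hF : 5 ≤ F) (hn : 2 * L + F ≤ 30)
    (hl : chk L true l 0 = true) (he : chk L false e 0 = true) :
    2 * tot L F l + tot L F e ≤ (setG (2 * L + F)).card := by
  obtain ⟨a1, a2⟩ := chk_sound _ _ _ _ hl
  obtain ⟨b1, b2⟩ := chk_sound _ _ _ _ he
  exact card_G hL hF hn l e (fun p hp => ⟨(a2 p hp).1, by simpa using (a2 p hp).2.1⟩) a1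
    (fun p hp => ⟨(b2 p hp).1, by simpa using (b2 p hp).2.1⟩) b1

theorem card_final : (setF 30).card ≤ ((Finset.Icc (0 : ℤ) 29).powerset.filter
      (fun A => (A - A).card < (A + A).card)).card := by
  apply Finset.card_le_card_of_injOn st
  · intro x hx
    have hx := (Finset.mem_filter.1 (Finset.mem_coe.1 hx)).2
    refine Finset.mem_coe.2 (Finset.mem_filter.2 ⟨Finset.mem_powerset.2 ?_, hx⟩)
    intro z hz
    obtain ⟨i, hi, -, rfl⟩ := (mem_st _ _).1 hz
    rw [Finset.mem_Icc]; omega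
  · intro x hx y hy h
    have hx := Finset.mem_range.1 (Finset.mem_filter.1 (Finset.mem_coe.1 hx)).1
    have hy := Finset.mem_range.1 (Finset.mem_filter.1 (Finset.mem_coe.1 hy)).1
    have key : ∀ u v : ℕ, u < 2 ^ 30 → st u = st v → ∀ i, u.testBit i = true → v.testBit i = true := by
      intro u v hu h i hi
      have : (i : ℤ) ∈ st u := (mem_st _ _).2 ⟨i, lt_of_testBit hu hi, hi, rfl⟩
      rw [h] at this
      obtain ⟨j, -, hj, e⟩ := (mem_st _ _).1 this
      have : j = i := by exact_mod_cast e
      rwa [← this]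
    apply Nat.eq_of_testBit_eq
    intro i
    rw [Bool.eq_iff_iff]
    exact ⟨key x y hx h i, key y x hy h.symm i⟩

/-! ### Certificates -/
def l19_0 : List (ℕ × ℕ) := [
  (1, 6), (3, 7), (5, 7)]
theorem tot_l19_0 : Nat.ble 12 (tot 3 13 l19_0) = true := by decide +kernel

def e19_0 : List (ℕ × ℕ) := [
  (3, 6), (5, 5), (7, 7)]
theorem tot_e19_0 : Nat.ble 18 (tot 3 13 e19_0) = true := by decide +kernel

theorem card_G19 : 42 ≤ (setG 19).card := by
  have h := card_G' (L := 3) (F := 13) (l19_0) (e19_0)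
    (by norm_num) (by norm_num) (by norm_num) (by decide +kernel) (by decide +kernel)
  try simp only [tot_append] at h
  change _ ≤ (setG 19).card at h
  have h_l19_0 := Nat.le_of_ble_eq_true tot_l19_0
  have h_e19_0 := Nat.le_of_ble_eq_true tot_e19_0
  omega

def l20_0 : List (ℕ × ℕ) := [
  (1, 5), (3, 7), (5, 7)]
theorem tot_l20_0 : Nat.ble 35 (tot 3 14 l20_0) = true := by decide +kernel

def e20_0 : List (ℕ × ℕ) := [
  (5, 5), (7, 7)]
theorem tot_e20_0 : Nat.ble 20 (tot 3 14 e20_0) = true := by decide +kernel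

theorem card_G20 : 90 ≤ (setG 20).card := by
  have h := card_G' (L := 3) (F := 14) (l20_0) (e20_0)
    (by norm_num) (by norm_num) (by norm_num) (by decide +kernel) (by decide +kernel)
  try simp only [tot_append] at h
  change _ ≤ (setG 20).card at h
  have h_l20_0 := Nat.le_of_ble_eq_true tot_l20_0
  have h_e20_0 := Nat.le_of_ble_eq_true tot_e20_0
  omega

def l21_0 : List (ℕ × ℕ) := [
  (1, 5), (1, 6), (3, 7), (5, 7)]
theorem tot_l21_0 : Nat.ble 67 (tot 3 15 l21_0) = true := by decide +kernel

def e21_0 : List (ℕ × ℕ) := [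
  (3, 6), (5, 5), (7, 7)]
theorem tot_e21_0 : Nat.ble 70 (tot 3 15 e21_0) = true := by decide +kernel

theorem card_G21 : 204 ≤ (setG 21).card := by
  have h := card_G' (L := 3) (F := 15) (l21_0) (e21_0)
    (by norm_num) (by norm_num) (by norm_num) (by decide +kernel) (by decide +kernel)
  try simp only [tot_append] at h
  change _ ≤ (setG 21).card at h
  have h_l21_0 := Nat.le_of_ble_eq_true tot_l21_0
  have h_e21_0 := Nat.le_of_ble_eq_true tot_e21_0
  omega

def l22_0 : List (ℕ × ℕ) := [
  (3, 14), (7, 11), (7, 13), (7, 15), (9, 13), (11, 11), (11, 15), (13, 15)]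
theorem tot_l22_0 : Nat.ble 151 (tot 4 14 l22_0) = true := by decide +kernel

def e22_0 : List (ℕ × ℕ) := [
  (7, 14), (9, 9), (11, 13), (13, 11), (15, 15)]
theorem tot_e22_0 : Nat.ble 68 (tot 4 14 e22_0) = true := by decide +kernel

theorem card_G22 : 370 ≤ (setG 22).card := by
  have h := card_G' (L := 4) (F := 14) (l22_0) (e22_0)
    (by norm_num) (by norm_num) (by norm_num) (by decide +kernel) (by decide +kernel)
  try simp only [tot_append] at h
  change _ ≤ (setG 22).card at h
  have h_l22_0 := Nat.le_of_ble_eq_true tot_l22_0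
  have h_e22_0 := Nat.le_of_ble_eq_true tot_e22_0
  omega

def l23_0 : List (ℕ × ℕ) := [
  (3, 13), (5, 11), (7, 11), (7, 13), (7, 15), (9, 11), (9, 13), (11, 11), (11, 15), (13, 15)]
theorem tot_l23_0 : Nat.ble 294 (tot 4 15 l23_0) = true := by decide +kernel

def e23_0 : List (ℕ × ℕ) := [
  (3, 12), (5, 10), (7, 14), (9, 9), (11, 13), (13, 11), (15, 15)]
theorem tot_e23_0 : Nat.ble 226 (tot 4 15 e23_0) = true := by decide +kernel

theorem card_G23 : 814 ≤ (setG 23).card := by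
  have h := card_G' (L := 4) (F := 15) (l23_0) (e23_0)
    (by norm_num) (by norm_num) (by norm_num) (by decide +kernel) (by decide +kernel)
  try simp only [tot_append] at h
  change _ ≤ (setG 23).card at h
  have h_l23_0 := Nat.le_of_ble_eq_true tot_l23_0
  have h_e23_0 := Nat.le_of_ble_eq_true tot_e23_0
  omega

def l24_0 : List (ℕ × ℕ) := [
  (1, 13), (3, 13), (3, 14), (3, 15), (5, 11), (7, 11), (7, 13), (7, 15), (9, 11), (9, 13),
  (11, 11), (11, 15), (13, 15)]
theorem tot_l24_0 : Nat.ble 697 (tot 4 16 l24_0) = true := by decide +kernel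

def e24_0 : List (ℕ × ℕ) := [
  (3, 12), (5, 10), (7, 14), (9, 9), (11, 13), (13, 11), (15, 15)]
theorem tot_e24_0 : Nat.ble 320 (tot 4 16 e24_0) = true := by decide +kernel

theorem card_G24 : 1714 ≤ (setG 24).card := by
  have h := card_G' (L := 4) (F := 16) (l24_0) (e24_0)
    (by norm_num) (by norm_num) (by norm_num) (by decide +kernel) (by decide +kernel)
  try simp only [tot_append] at h
  change _ ≤ (setG 24).card at h
  have h_l24_0 := Nat.le_of_ble_eq_true tot_l24_0
  have h_e24_0 := Nat.le_of_ble_eq_true tot_e24_0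
  omega

def l25_0 : List (ℕ × ℕ) := [
  (1, 22), (1, 26), (1, 28), (3, 25), (3, 28), (5, 21), (5, 22), (5, 23), (7, 22), (7, 23),
  (7, 25), (7, 26), (7, 27), (7, 29), (7, 30), (7, 31), (9, 19), (9, 22), (11, 19), (11, 25),
  (11, 27), (11, 29), (11, 30), (13, 19), (13, 23), (13, 25), (13, 29), (13, 30), (15, 23),
  (15, 25), (15, 27), (15, 29), (15, 31), (17, 19), (17, 25), (19, 29), (21, 23), (23, 23),
  (23, 27), (23, 31), (25, 23), (25, 27), (27, 23), (27, 31), (29, 31)]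
theorem tot_l25_0 : Nat.ble 1625 (tot 5 15 l25_0) = true := by decide +kernel

def e25_0 : List (ℕ × ℕ) := [
  (5, 20), (7, 28), (11, 26), (13, 22), (15, 30), (19, 25), (21, 21), (23, 29), (25, 19),
  (27, 27), (29, 23), (31, 31)]
theorem tot_e25_0 : Nat.ble 278 (tot 5 15 e25_0) = true := by decide +kernel

theorem card_G25 : 3528 ≤ (setG 25).card := by
  have h := card_G' (L := 5) (F := 15) (l25_0) (e25_0)
    (by norm_num) (by norm_num) (by norm_num) (by decide +kernel) (by decide +kernel)
  try simp only [tot_append] at h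
  change _ ≤ (setG 25).card at h
  have h_l25_0 := Nat.le_of_ble_eq_true tot_l25_0
  have h_e25_0 := Nat.le_of_ble_eq_true tot_e25_0
  omega

def l26_0 : List (ℕ × ℕ) := [
  (1, 22), (1, 26), (3, 25), (3, 28), (5, 21), (5, 22), (5, 23), (5, 26), (7, 22), (7, 26),
  (7, 27), (7, 29), (7, 30), (7, 31), (9, 22), (11, 19), (11, 23), (11, 25), (11, 27), (11, 29),
  (11, 30), (11, 31), (13, 19), (13, 21), (13, 23), (13, 25), (13, 27), (13, 29), (13, 30),
  (15, 23), (15, 25), (15, 27)]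
theorem tot_l26_0 : Nat.ble 2730 (tot 5 16 l26_0) = true := by decide +kernel

def l26_1 : List (ℕ × ℕ) := [
  (15, 29), (15, 31), (19, 27), (19, 29), (19, 31), (21, 23), (23, 23), (23, 27), (23, 31),
  (25, 23), (25, 27), (27, 23), (27, 31)]
theorem tot_l26_1 : Nat.ble 505 (tot 5 16 l26_1) = true := by decide +kernel

def e26_0 : List (ℕ × ℕ) := [
  (5, 20), (7, 28), (11, 26), (13, 22), (15, 30), (19, 25), (23, 29), (25, 19), (27, 27),
  (29, 23), (31, 31)]
theorem tot_e26_0 : Nat.ble 474 (tot 5 16 e26_0) = true := by decide +kernel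

theorem card_G26 : 6944 ≤ (setG 26).card := by
  have h := card_G' (L := 5) (F := 16) (l26_0 ++ (l26_1)) (e26_0)
    (by norm_num) (by norm_num) (by norm_num) (by decide +kernel) (by decide +kernel)
  try simp only [tot_append] at h
  change _ ≤ (setG 26).card at h
  have h_l26_0 := Nat.le_of_ble_eq_true tot_l26_0
  have h_l26_1 := Nat.le_of_ble_eq_true tot_l26_1
  have h_e26_0 := Nat.le_of_ble_eq_true tot_e26_0
  omega

def l27_0 : List (ℕ × ℕ) := [
  (1, 44), (1, 52), (1, 54), (1, 57), (5, 41), (5, 42), (7, 53), (7, 54), (7, 55), (7, 57),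
  (7, 58), (7, 60), (7, 61), (11, 39), (11, 41), (11, 57), (11, 58), (11, 59), (13, 37),
  (13, 39), (13, 41), (13, 43), (13, 45), (13, 46), (13, 47), (13, 50), (13, 57), (15, 45),
  (15, 46), (15, 51), (15, 53), (15, 54), (15, 55), (15, 57), (15, 58), (15, 59), (15, 61),
  (15, 62), (19, 35), (19, 49), (19, 51), (19, 53), (19, 58), (23, 45), (23, 46), (23, 47),
  (23, 51), (23, 53), (23, 54), (23, 55), (23, 57), (23, 59), (23, 61), (23, 62), (23, 63),
  (25, 39), (25, 55), (27, 39), (27, 45), (27, 46), (27, 47), (27, 53), (27, 55), (27, 57)]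
theorem tot_l27_0 : Nat.ble 5390 (tot 6 15 l27_0) = true := by decide +kernel

def l27_1 : List (ℕ × ℕ) := [
  (27, 59), (27, 61), (27, 62), (27, 63), (29, 39), (29, 41), (29, 43), (29, 45), (29, 47),
  (29, 59), (29, 61), (29, 62), (31, 47), (31, 53), (31, 55), (31, 57), (31, 59), (31, 61),
  (31, 63), (33, 49), (33, 57), (35, 57), (37, 43), (37, 45), (37, 53), (39, 45), (39, 51),
  (39, 53), (39, 55), (39, 59), (39, 61), (41, 39), (41, 45), (41, 55), (43, 39), (43, 55),
  (43, 59), (43, 61), (43, 63), (45, 39), (45, 47), (45, 61), (47, 51), (47, 55), (47, 59),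
  (49, 39), (49, 43), (49, 51), (49, 55), (51, 39), (51, 59), (55, 47), (55, 55), (55, 63),
  (57, 47), (57, 55), (59, 47), (59, 63)]
theorem tot_l27_1 : Nat.ble 1477 (tot 6 15 l27_1) = true := by decide +kernel

def e27_0 : List (ℕ × ℕ) := [
  (7, 56), (11, 52), (13, 44), (15, 60), (19, 50), (21, 42), (23, 58), (25, 38), (27, 54),
  (29, 46), (31, 62), (35, 49), (39, 57), (41, 37), (43, 53), (45, 45), (47, 61), (51, 51),
  (53, 43), (55, 59), (57, 39), (59, 55), (61, 47)]
theorem tot_e27_0 : Nat.ble 708 (tot 6 15 e27_0) = true := by decide +kernel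

theorem card_G27 : 14442 ≤ (setG 27).card := by
  have h := card_G' (L := 6) (F := 15) (l27_0 ++ (l27_1)) (e27_0)
    (by norm_num) (by norm_num) (by norm_num) (by decide +kernel) (by decide +kernel)
  try simp only [tot_append] at h
  change _ ≤ (setG 27).card at h
  have h_l27_0 := Nat.le_of_ble_eq_true tot_l27_0
  have h_l27_1 := Nat.le_of_ble_eq_true tot_l27_1
  have h_e27_0 := Nat.le_of_ble_eq_true tot_e27_0
  omega

def l28_0 : List (ℕ × ℕ) := [
  (1, 44), (1, 52), (1, 54), (3, 49), (3, 56), (5, 42), (7, 53), (7, 54), (7, 55), (7, 60),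
  (9, 54), (11, 39), (11, 41), (11, 57), (11, 58), (11, 60), (13, 37), (13, 39), (13, 41),
  (13, 45), (13, 46), (13, 47), (13, 50), (13, 55), (13, 57), (15, 45), (15, 46), (15, 51),
  (15, 53), (15, 54), (15, 55), (15, 57)]
theorem tot_l28_0 : Nat.ble 6347 (tot 6 16 l28_0) = true := by decide +kernel

def l28_1 : List (ℕ × ℕ) := [
  (15, 58), (15, 59), (15, 61), (15, 62), (19, 35), (19, 49), (19, 51), (19, 53), (19, 54),
  (19, 58), (23, 45), (23, 51), (23, 53), (23, 54), (23, 55), (23, 57), (23, 59), (23, 61),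
  (23, 62), (25, 39), (25, 53), (25, 54), (25, 55), (27, 39), (27, 45), (27, 46), (27, 47),
  (27, 51), (27, 53), (27, 55), (27, 57), (27, 59)]
theorem tot_l28_1 : Nat.ble 4353 (tot 6 16 l28_1) = true := by decide +kernel

def l28_2 : List (ℕ × ℕ) := [
  (27, 61), (27, 62), (27, 63), (29, 39), (29, 43), (29, 45), (29, 47), (29, 53), (29, 55),
  (29, 59), (29, 61), (31, 45), (31, 47), (31, 51), (31, 53), (31, 55), (31, 57), (31, 59),
  (31, 61), (31, 63), (35, 57), (37, 43), (37, 53), (39, 45), (39, 51), (39, 53), (39, 55),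
  (39, 59), (39, 61), (39, 63), (41, 39), (41, 45)]
theorem tot_l28_2 : Nat.ble 1893 (tot 6 16 l28_2) = true := by decide +kernel

def l28_3 : List (ℕ × ℕ) := [
  (43, 39), (43, 55), (43, 59), (43, 61), (43, 63), (45, 39), (45, 43), (45, 47), (45, 55),
  (45, 59), (45, 61), (47, 47), (47, 51), (47, 55), (47, 59), (47, 63), (49, 39), (49, 51),
  (51, 55), (51, 59), (55, 47), (55, 55), (55, 63), (57, 55), (59, 47), (59, 63)]
theorem tot_l28_3 : Nat.ble 853 (tot 6 16 l28_3) = true := by decide +kernel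

def e28_0 : List (ℕ × ℕ) := [
  (3, 48), (7, 56), (11, 52), (13, 44), (15, 60), (19, 50), (21, 42), (23, 58), (25, 38),
  (27, 54), (31, 62), (39, 57), (45, 45), (47, 61), (51, 51), (53, 43), (55, 59), (57, 39),
  (61, 47), (63, 63)]
theorem tot_e28_0 : Nat.ble 832 (tot 6 16 e28_0) = true := by decide +kernel

theorem card_G28 : 27724 ≤ (setG 28).card := by
  have h := card_G' (L := 6) (F := 16) (l28_0 ++ (l28_1 ++ (l28_2 ++ (l28_3)))) (e28_0)
    (by norm_num) (by norm_num) (by norm_num) (by decide +kernel) (by decide +kernel)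
  try simp only [tot_append] at h
  change _ ≤ (setG 28).card at h
  have h_l28_0 := Nat.le_of_ble_eq_true tot_l28_0
  have h_l28_1 := Nat.le_of_ble_eq_true tot_l28_1
  have h_l28_2 := Nat.le_of_ble_eq_true tot_l28_2
  have h_l28_3 := Nat.le_of_ble_eq_true tot_l28_3
  have h_e28_0 := Nat.le_of_ble_eq_true tot_e28_0
  omega

def l29_0 : List (ℕ × ℕ) := [
  (1, 88), (1, 90), (1, 104), (1, 108), (1, 114), (7, 88), (7, 113), (7, 120), (11, 73),
  (11, 78), (11, 83), (11, 105), (11, 114), (11, 115), (11, 116), (13, 73), (13, 75), (13, 78),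
  (13, 82), (13, 83), (13, 89), (13, 90), (13, 91), (13, 92), (13, 94), (13, 101), (13, 114),
  (13, 115), (15, 91), (15, 92), (15, 102), (15, 103), (15, 106), (15, 107), (15, 108),
  (15, 109), (15, 110), (15, 111), (15, 114), (15, 115), (15, 116), (15, 117), (15, 118),
  (15, 119), (15, 121), (15, 122), (15, 123), (15, 124), (15, 125), (17, 70), (19, 108),
  (21, 69), (21, 81), (21, 85), (21, 86), (21, 87), (23, 90), (23, 91), (23, 92), (23, 94),
  (23, 101), (23, 102), (23, 107), (23, 108)]
theorem tot_l29_0 : Nat.ble 11476 (tot 7 15 l29_0) = true := by decide +kernel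

def l29_1 : List (ℕ × ℕ) := [
  (23, 109), (23, 110), (23, 111), (23, 113), (23, 114), (23, 115), (23, 117), (23, 118),
  (23, 119), (23, 121), (23, 122), (23, 123), (23, 124), (23, 125), (25, 77), (25, 98),
  (25, 102), (25, 107), (27, 71), (27, 75), (27, 77), (27, 78), (27, 79), (27, 92), (27, 94),
  (27, 101), (27, 102), (27, 103), (27, 105), (27, 106), (27, 107), (27, 109), (27, 110),
  (27, 111), (27, 113), (27, 114), (27, 115), (27, 117), (27, 118), (27, 119), (27, 121),
  (27, 122), (27, 123), (27, 124), (27, 125), (27, 126), (29, 78), (29, 79), (29, 83), (29, 86),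
  (29, 89), (29, 90), (29, 91), (29, 93), (29, 94), (29, 95), (29, 107), (29, 113), (29, 114),
  (29, 117), (29, 118), (29, 121), (29, 123), (31, 93)]
theorem tot_l29_1 : Nat.ble 7865 (tot 7 15 l29_1) = true := by decide +kernel

def l29_2 : List (ℕ × ℕ) := [
  (31, 94), (31, 103), (31, 107), (31, 109), (31, 110), (31, 111), (31, 114), (31, 115),
  (31, 117), (31, 118), (31, 119), (31, 121), (31, 122), (31, 123), (31, 125), (31, 126),
  (35, 97), (35, 101), (35, 114), (35, 115), (39, 67), (39, 90), (39, 91), (39, 93), (39, 99),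
  (39, 102), (39, 105), (39, 106), (39, 107), (39, 109), (39, 110), (39, 111), (39, 113),
  (39, 115), (39, 117), (39, 118), (39, 121), (39, 122), (39, 123), (39, 125), (41, 75),
  (41, 91), (41, 107), (43, 78), (43, 101), (43, 107), (43, 109), (43, 110), (43, 111),
  (43, 115), (43, 117), (43, 118), (43, 121), (43, 122), (43, 123), (45, 73), (45, 75),
  (45, 78), (45, 89), (45, 91), (45, 93), (45, 94), (45, 107), (45, 110)]
theorem tot_l29_2 : Nat.ble 3567 (tot 7 15 l29_2) = true := by decide +kernel

def l29_3 : List (ℕ × ℕ) := [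
  (45, 115), (45, 117), (45, 118), (47, 93), (47, 102), (47, 103), (47, 107), (47, 109),
  (47, 110), (47, 111), (47, 113), (47, 115), (47, 117), (47, 118), (47, 119), (47, 121),
  (47, 123), (47, 125), (49, 78), (49, 101), (51, 71), (51, 101), (51, 103), (51, 109),
  (51, 117), (51, 121), (53, 81), (53, 83), (53, 87), (53, 91), (53, 93), (55, 91), (55, 93),
  (55, 94), (55, 95), (55, 101), (55, 103), (55, 107), (55, 109), (55, 110), (55, 111),
  (55, 113), (55, 115), (55, 117), (55, 119), (55, 121), (55, 123), (55, 125), (55, 126),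
  (57, 75), (57, 77), (57, 79), (57, 91), (57, 107), (57, 109), (57, 110), (57, 111), (59, 79),
  (59, 94), (59, 107), (59, 109), (59, 111), (59, 113), (59, 115)]
theorem tot_l29_3 : Nat.ble 2646 (tot 7 15 l29_3) = true := by decide +kernel

def l29_4 : List (ℕ × ℕ) := [
  (59, 117), (59, 121), (59, 123), (59, 125), (59, 126), (61, 79), (61, 83), (61, 87), (61, 89),
  (61, 91), (61, 93), (61, 95), (61, 107), (61, 117), (61, 123), (63, 107), (63, 109),
  (63, 111), (63, 115), (63, 117), (63, 123), (63, 125), (67, 113), (69, 83), (71, 107),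
  (71, 109), (71, 121), (75, 79), (75, 115), (75, 117), (77, 75), (77, 83), (77, 87), (77, 91),
  (77, 93), (77, 95), (77, 101), (77, 115), (79, 91), (79, 93), (79, 103), (79, 107), (79, 109),
  (79, 111), (79, 115), (79, 117), (79, 119), (79, 123), (79, 125), (81, 77), (83, 71),
  (83, 103), (83, 107), (85, 87), (87, 71), (87, 91), (87, 93), (87, 95), (87, 107), (87, 109),
  (87, 115), (87, 119), (87, 123), (87, 125)]
theorem tot_l29_4 : Nat.ble 2053 (tot 7 15 l29_4) = true := by decide +kernel

def l29_5 : List (ℕ × ℕ) := [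
  (91, 79), (91, 91), (91, 93), (91, 95), (91, 107), (91, 111), (91, 115), (91, 119), (91, 123),
  (91, 125), (93, 83), (93, 87), (93, 91), (93, 95), (93, 115), (93, 119), (95, 91), (95, 95),
  (95, 103), (95, 111), (95, 115), (95, 119), (95, 127), (97, 107), (99, 103), (99, 115),
  (101, 87), (101, 91), (101, 107), (103, 103), (103, 107), (103, 111), (103, 119), (103, 123),
  (105, 91), (105, 107), (107, 79), (107, 111), (107, 123), (109, 79), (109, 87), (109, 95),
  (109, 111), (111, 103), (111, 111), (111, 119), (113, 79), (113, 103), (121, 111)]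
theorem tot_l29_5 : Nat.ble 955 (tot 7 15 l29_5) = true := by decide +kernel

def e29_0 : List (ℕ × ℕ) := [
  (7, 112), (15, 120), (19, 100), (21, 84), (23, 116), (25, 76), (27, 108), (29, 92), (31, 124),
  (35, 98), (43, 106), (45, 90), (49, 70), (51, 102), (53, 86), (57, 78), (59, 110), (81, 69),
  (83, 101), (85, 85), (87, 117), (93, 93), (95, 125), (99, 99), (101, 83), (105, 75),
  (107, 107), (109, 91), (111, 123), (113, 71), (117, 87), (119, 119), (121, 79), (125, 95)]
theorem tot_e29_0 : Nat.ble 1080 (tot 7 15 e29_0) = true := by decide +kernel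

theorem card_G29 : 58204 ≤ (setG 29).card := by
  have h := card_G' (L := 7) (F := 15) (l29_0 ++ (l29_1 ++ (l29_2 ++ (l29_3 ++ (l29_4 ++ (l29_5)))))) (e29_0)
    (by norm_num) (by norm_num) (by norm_num) (by decide +kernel) (by decide +kernel)
  try simp only [tot_append] at h
  change _ ≤ (setG 29).card at h
  have h_l29_0 := Nat.le_of_ble_eq_true tot_l29_0
  have h_l29_1 := Nat.le_of_ble_eq_true tot_l29_1
  have h_l29_2 := Nat.le_of_ble_eq_true tot_l29_2
  have h_l29_3 := Nat.le_of_ble_eq_true tot_l29_3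
  have h_l29_4 := Nat.le_of_ble_eq_true tot_l29_4
  have h_l29_5 := Nat.le_of_ble_eq_true tot_l29_5
  have h_e29_0 := Nat.le_of_ble_eq_true tot_e29_0
  omega

def l30_0 : List (ℕ × ℕ) := [
  (1, 88), (1, 104), (1, 108), (1, 114), (7, 120), (11, 73), (11, 78), (11, 83), (11, 105),
  (11, 114), (11, 115), (11, 116), (13, 75), (13, 78), (13, 82), (13, 83), (13, 89), (13, 92),
  (13, 101), (13, 114), (15, 91), (15, 92), (15, 102), (15, 103), (15, 106), (15, 107),
  (15, 108), (15, 109), (15, 110), (15, 111), (15, 114), (15, 115)]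
theorem tot_l30_0 : Nat.ble 20492 (tot 7 16 l30_0) = true := by decide +kernel

def l30_1 : List (ℕ × ℕ) := [
  (15, 117), (15, 118), (15, 119), (15, 121), (15, 122), (15, 123), (21, 69), (21, 81),
  (23, 90), (23, 91), (23, 101), (23, 102), (23, 106), (23, 107), (23, 108), (23, 109),
  (23, 110), (23, 111), (23, 114), (23, 115), (23, 117), (23, 118), (23, 121), (23, 122),
  (23, 123), (25, 77), (25, 107), (27, 73), (27, 75), (27, 78), (27, 79), (27, 92)]
theorem tot_l30_1 : Nat.ble 5457 (tot 7 16 l30_1) = true := by decide +kernel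

def l30_2 : List (ℕ × ℕ) := [
  (27, 94), (27, 103), (27, 105), (27, 106), (27, 107), (27, 109), (27, 110), (27, 111),
  (27, 113), (27, 114), (27, 115), (27, 117), (27, 118), (27, 119), (27, 121), (27, 122),
  (27, 123), (27, 124), (29, 78), (29, 79), (29, 83), (29, 86), (29, 89), (29, 90), (29, 91),
  (29, 93), (29, 94), (29, 107), (29, 118), (29, 123), (31, 91), (31, 94)]
theorem tot_l30_2 : Nat.ble 11937 (tot 7 16 l30_2) = true := by decide +kernel

def l30_3 : List (ℕ × ℕ) := [
  (31, 103), (31, 106), (31, 107), (31, 109), (31, 110), (31, 111), (31, 114), (31, 115),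
  (31, 117), (31, 118), (31, 119), (31, 121), (31, 122), (31, 123), (31, 125), (35, 97),
  (35, 101), (35, 114), (39, 67), (39, 90), (39, 91), (39, 99), (39, 102), (39, 105), (39, 106),
  (39, 107), (39, 109), (39, 110), (39, 113), (39, 115), (39, 117), (39, 118)]
theorem tot_l30_3 : Nat.ble 4739 (tot 7 16 l30_3) = true := by decide +kernel

def l30_4 : List (ℕ × ℕ) := [
  (39, 121), (39, 122), (39, 123), (39, 125), (41, 91), (43, 78), (43, 83), (43, 101),
  (43, 109), (43, 115), (43, 117), (43, 118), (43, 119), (43, 121), (43, 125), (45, 75),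
  (45, 78), (45, 87), (45, 89), (45, 91), (45, 93), (45, 94), (45, 95), (45, 110), (45, 117),
  (45, 121), (47, 93), (47, 94), (47, 102), (47, 103), (47, 107), (47, 109)]
theorem tot_l30_4 : Nat.ble 3199 (tot 7 16 l30_4) = true := by decide +kernel

def l30_5 : List (ℕ × ℕ) := [
  (47, 110), (47, 111), (47, 113), (47, 115), (47, 117), (47, 118), (47, 119), (47, 121),
  (47, 123), (47, 125), (47, 126), (49, 78), (49, 101), (51, 71), (51, 101), (51, 103),
  (51, 117), (53, 83), (53, 87), (53, 91), (55, 91), (55, 94), (55, 103), (55, 107), (55, 109),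
  (55, 110), (55, 111), (55, 115), (55, 117), (55, 121), (55, 123), (55, 126)]
theorem tot_l30_5 : Nat.ble 2716 (tot 7 16 l30_5) = true := by decide +kernel

def l30_6 : List (ℕ × ℕ) := [
  (57, 77), (57, 79), (57, 107), (57, 109), (57, 110), (57, 111), (59, 79), (59, 94), (59, 103),
  (59, 107), (59, 109), (59, 113), (59, 115), (59, 117), (59, 119), (59, 121), (59, 123),
  (59, 125), (59, 126), (61, 89), (61, 91), (61, 93), (61, 95), (61, 123), (63, 115), (63, 119),
  (63, 123), (67, 113), (71, 107), (71, 109), (73, 109), (75, 115)]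
theorem tot_l30_6 : Nat.ble 2863 (tot 7 16 l30_6) = true := by decide +kernel

def l30_7 : List (ℕ × ℕ) := [
  (75, 117), (77, 75), (77, 83), (77, 91), (77, 93), (77, 115), (79, 91), (79, 93), (79, 103),
  (79, 107), (79, 109), (79, 111), (79, 115), (79, 117), (79, 119), (79, 123), (79, 125),
  (83, 103), (83, 107), (87, 107), (87, 109), (87, 111), (87, 115), (87, 123), (91, 79),
  (91, 93), (91, 107), (91, 111), (91, 115), (91, 119), (91, 123), (91, 125)]
theorem tot_l30_7 : Nat.ble 3075 (tot 7 16 l30_7) = true := by decide +kernel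

def l30_8 : List (ℕ × ℕ) := [
  (93, 91), (93, 107), (95, 107), (95, 111), (95, 115), (95, 123), (99, 115), (101, 87),
  (101, 107), (103, 107), (103, 111), (103, 123), (107, 79), (107, 111), (107, 119), (109, 95),
  (111, 103), (111, 111), (111, 119), (113, 103), (119, 111), (121, 111)]
theorem tot_l30_8 : Nat.ble 940 (tot 7 16 l30_8) = true := by decide +kernel

def e30_0 : List (ℕ × ℕ) := [
  (15, 120), (45, 90), (47, 122), (61, 94), (71, 113), (79, 121), (89, 77), (101, 83),
  (103, 115)]
theorem tot_e30_0 : Nat.ble 566 (tot 7 16 e30_0) = true := by decide +kernel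

theorem card_G30 : 111402 ≤ (setG 30).card := by
  have h := card_G' (L := 7) (F := 16) (l30_0 ++ (l30_1 ++ (l30_2 ++ (l30_3 ++ (l30_4 ++ (l30_5 ++ (l30_6 ++ (l30_7 ++ (l30_8))))))))) (e30_0)
    (by norm_num) (by norm_num) (by norm_num) (by decide +kernel) (by decide +kernel)
  try simp only [tot_append] at h
  change _ ≤ (setG 30).card at h
  have h_l30_0 := Nat.le_of_ble_eq_true tot_l30_0
  have h_l30_1 := Nat.le_of_ble_eq_true tot_l30_1
  have h_l30_2 := Nat.le_of_ble_eq_true tot_l30_2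
  have h_l30_3 := Nat.le_of_ble_eq_true tot_l30_3
  have h_l30_4 := Nat.le_of_ble_eq_true tot_l30_4
  have h_l30_5 := Nat.le_of_ble_eq_true tot_l30_5
  have h_l30_6 := Nat.le_of_ble_eq_true tot_l30_6
  have h_l30_7 := Nat.le_of_ble_eq_true tot_l30_7
  have h_l30_8 := Nat.le_of_ble_eq_true tot_l30_8
  have h_e30_0 := Nat.le_of_ble_eq_true tot_e30_0
  omega

theorem arith_final (F H G : ℕ → ℕ)
    (hF : ∀ n, n < 30 → F n + H (n + 1) ≤ F (n + 1))
    (hH : ∀ n, H n + G (n + 1) ≤ H (n + 1))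
    (g19 : 42 ≤ G 19)
    (g20 : 90 ≤ G 20)
    (g21 : 204 ≤ G 21)
    (g22 : 370 ≤ G 22)
    (g23 : 814 ≤ G 23)
    (g24 : 1714 ≤ G 24)
    (g25 : 3528 ≤ G 25)
    (g26 : 6944 ≤ G 26)
    (g27 : 14442 ≤ G 27)
    (g28 : 27724 ≤ G 28)
    (g29 : 58204 ≤ G 29)
    (g30 : 111402 ≤ G 30) : 450000 ≤ F 30 := by
  have f19 := hF 18 (by norm_num)
  have h19 := hH 18
  have f20 := hF 19 (by norm_num)
  have h20 := hH 19
  have f21 := hF 20 (by norm_num)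
  have h21 := hH 20
  have f22 := hF 21 (by norm_num)
  have h22 := hH 21
  have f23 := hF 22 (by norm_num)
  have h23 := hH 22
  have f24 := hF 23 (by norm_num)
  have h24 := hH 23
  have f25 := hF 24 (by norm_num)
  have h25 := hH 24
  have f26 := hF 25 (by norm_num)
  have h26 := hH 25
  have f27 := hF 26 (by norm_num)
  have h27 := hH 26
  have f28 := hF 27 (by norm_num)
  have h28 := hH 27
  have f29 := hF 28 (by norm_num)
  have h29 := hH 28
  have f30 := hF 29 (by norm_num)
  have h30 := hH 29
  simp only [Nat.reduceAdd] at *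
  omega

theorem many_mstd_subsets_of_0_29 :
    450000 ≤ ((Finset.Icc (0 : ℤ) 29).powerset.filter
      (fun A => (A - A).card < (A + A).card)).card :=
  le_trans (arith_final (fun n => (setF n).card) (fun n => (setH n).card) (fun n => (setG n).card)
    card_F card_H card_G19 card_G20 card_G21 card_G22 card_G23 card_G24 card_G25 card_G26 card_G27 card_G28 card_G29 card_G30) card_final
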